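/- arXiv:2307.01176 — 2 statements merged into one kernel-verified Lean document; each statement's English description precedes it below -/
import Mathlib

section
/- Let α, β, F be real numbers, N ∈ ℕ, let φ : ℝ → ℂ be three times differentiable and satisfy -iβφ''(x) - (1+iα)φ(x) + i|φ(x)|²φ(x) + F = 0 for all x ∈ ℝ, let ψ : ℝ × [0,∞) → ℂ be differentiable in t and twice differentiable in x with ψ_t = -iβψ_xx - (1+iα)ψ + i|ψ|²ψ + F pointwise, let γ : ℝ × [0,∞) → ℝ be differentiable in t and twice differentiable in x, and let σ : [0,∞) → ℝ be differentiable. Set θ(x,t) = x + γ(x,t) + σ(t)/N, define the modulated wave ∘φ(x,t) = φ(θ(x,t)) and the forward-modulated perturbation ∘v(x,t) = ψ(x,t) - ∘φ(x,t). Then ∘v satisfies pointwise: ∘v_t = -iβ∘v_xx - (1+iα)∘v + i(2|∘φ|²∘v + ∘φ²·conj(∘v)) + i(2∘φ|∘v|² + conj(∘φ)·∘v² + |∘v|²∘v) - iβ(φ''(θ)(2γ_x + γ_x²) + φ'(θ)γ_xx) - φ'(θ)(γ_t + σ'(t)/N). -/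
open Complex (I normSq)
open ComplexConjugate

/-- Second derivative of a composition `f ∘ g` with `f : ℝ → ℂ` and a real phase `g`. -/
lemma hasDerivAt_deriv_comp_real {f : ℝ → ℂ} {g : ℝ → ℝ} (hf : Differentiable ℝ f)
    (hf' : Differentiable ℝ (deriv f)) (hg : Differentiable ℝ g)
    (hg' : Differentiable ℝ (deriv g)) (x : ℝ) :
    HasDerivAt (deriv fun y => f (g y))
      (deriv (deriv f) (g x) * ((deriv g x : ℝ) : ℂ) ^ 2 + deriv f (g x) * ((deriv (deriv g) x : ℝ) : ℂ)) x := by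
  have h : (deriv fun y => f (g y)) = fun y => ((deriv g y : ℝ) : ℂ) * deriv f (g y) := by
    funext y
    simpa [Function.comp_def] using
      ((hf (g y)).hasDerivAt.scomp y (hg y).hasDerivAt).deriv
  rw [h]
  have h₂ := (hg' x).hasDerivAt.ofReal_comp.mul
    ((hf' (g x)).hasDerivAt.scomp x (hg x).hasDerivAt)
  refine h₂.congr_deriv ?_
  simp only [Function.comp_apply, Complex.real_smul]
  ring

/-- Expansion of the cubic nonlinearity `|z|²z` about `w`. -/
lemma normSq_mul_self_add (w v : ℂ) :
    (normSq (w + v) : ℂ) * (w + v) = (normSq w : ℂ) * w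
      + (2 * (normSq w : ℂ) * v + w ^ 2 * conj v)
      + (2 * w * (normSq v : ℂ) + conj w * v ^ 2 + (normSq v : ℂ) * v) := by
  simp only [Complex.normSq_eq_conj_mul_self, map_add]
  ring

/-- The forward-modulated perturbation
`∘v(x,t) = ψ(x,t) - φ(x + γ(x,t) + σ(t)/N)` of a solution `ψ` of the Lugiato–Lefever
equation about a stationary solution `φ` satisfies the semilinear equation
`∘v_t = -iβ∘v_xx - (1+iα)∘v + i(2|∘φ|²∘v + ∘φ²conj(∘v)) + i(2∘φ|∘v|² + conj(∘φ)∘v² + |∘v|²∘v)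
  - iβ(φ''(θ)(2γ_x + γ_x²) + φ'(θ)γ_xx) - φ'(θ)(γ_t + σ'(t)/N)`. -/
theorem forward_modulated_perturbation_equation
    (α β F : ℝ) (N : ℕ) (hN : 0 < N)
    (φ : ℝ → ℂ) (ψ : ℝ → ℝ → ℂ) (γ : ℝ → ℝ → ℝ) (σ : ℝ → ℝ)
    (hφ : Differentiable ℝ φ)
    (hφ' : Differentiable ℝ (deriv φ))
    (hφ'' : Differentiable ℝ (deriv (deriv φ)))
    (hprofile : ∀ x : ℝ,
      -I * (β : ℂ) * deriv (deriv φ) x - (1 + I * (α : ℂ)) * φ x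
        + I * (normSq (φ x) : ℂ) * φ x + (F : ℂ) = 0)
    (hψt : ∀ x : ℝ, ∀ t : ℝ, 0 ≤ t → DifferentiableAt ℝ (fun s => ψ x s) t)
    (hψx : ∀ t : ℝ, 0 ≤ t → Differentiable ℝ (fun y => ψ y t))
    (hψxx : ∀ t : ℝ, 0 ≤ t → Differentiable ℝ (deriv (fun y => ψ y t)))
    (hLLE : ∀ x : ℝ, ∀ t : ℝ, 0 ≤ t →
      deriv (fun s => ψ x s) t =
        -I * (β : ℂ) * deriv (deriv (fun y => ψ y t)) x - (1 + I * (α : ℂ)) * ψ x t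
          + I * (normSq (ψ x t) : ℂ) * ψ x t + (F : ℂ))
    (hγt : ∀ x : ℝ, ∀ t : ℝ, 0 ≤ t → DifferentiableAt ℝ (fun s => γ x s) t)
    (hγx : ∀ t : ℝ, 0 ≤ t → Differentiable ℝ (fun y => γ y t))
    (hγxx : ∀ t : ℝ, 0 ≤ t → Differentiable ℝ (deriv (fun y => γ y t)))
    (hσ : Differentiable ℝ σ)
    -- the phase `θ`, the modulated wave `∘φ` and the forward-modulated perturbation `∘v`
    (θ : ℝ → ℝ → ℝ) (φm vm : ℝ → ℝ → ℂ)
    (hθ : ∀ x t : ℝ, θ x t = x + γ x t + σ t / N)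
    (hφm : ∀ x t : ℝ, φm x t = φ (θ x t))
    (hvm : ∀ x t : ℝ, vm x t = ψ x t - φm x t)
    -- the partial derivatives of the modulation `γ`
    (γx γxx γt : ℝ → ℝ → ℝ)
    (hγx' : ∀ x t : ℝ, γx x t = deriv (fun y => γ y t) x)
    (hγxx' : ∀ x t : ℝ, γxx x t = deriv (deriv (fun y => γ y t)) x)
    (hγt' : ∀ x t : ℝ, γt x t = deriv (fun s => γ x s) t) :
    ∀ x : ℝ, ∀ t : ℝ, 0 ≤ t →
      deriv (fun s => vm x s) t =
        -I * (β : ℂ) * deriv (deriv (fun y => vm y t)) x - (1 + I * (α : ℂ)) * vm x t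
          + I * (2 * (normSq (φm x t) : ℂ) * vm x t + (φm x t) ^ 2 * conj (vm x t))
          + I * (2 * φm x t * (normSq (vm x t) : ℂ) + conj (φm x t) * (vm x t) ^ 2
            + (normSq (vm x t) : ℂ) * vm x t)
          - I * (β : ℂ) * (deriv (deriv φ) (θ x t) * (2 * (γx x t : ℂ) + (γx x t : ℂ) ^ 2)
            + deriv φ (θ x t) * (γxx x t : ℂ))
          - deriv φ (θ x t) * ((γt x t : ℂ) + ((deriv σ t : ℝ) : ℂ) / (N : ℂ)) := by
  intro x t ht
  have hvx : (fun y => vm y t) = fun y => ψ y t - φ (θ y t) := by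
    funext y
    rw [hvm, hφm]
  have hvt : (fun s => vm x s) = fun s => ψ x s - φ (θ x s) := by
    funext s
    rw [hvm, hφm]
  have hθt : HasDerivAt (fun s => θ x s) (γt x t + deriv σ t / N) t := by
    simp only [hθ, hγt']
    exact ((hγt x t ht).hasDerivAt.const_add x).add ((hσ t).hasDerivAt.div_const _)
  have hθx : ∀ y, HasDerivAt (fun y => θ y t) (1 + deriv (fun y => γ y t) y) y := by
    intro y
    simp only [hθ]
    exact ((hasDerivAt_id y).add (hγx t ht y).hasDerivAt).add_const _
  have hθ_deriv : deriv (fun y => θ y t) = fun y => 1 + deriv (fun y => γ y t) y :=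
    funext fun y => (hθx y).deriv
  have hθ_diff : Differentiable ℝ fun y => θ y t := fun y => (hθx y).differentiableAt
  have hθ_diff' : Differentiable ℝ (deriv fun y => θ y t) := by
    rw [hθ_deriv]
    exact (hγxx t ht).const_add 1
  have hv_t : deriv (fun s => vm x s) t = deriv (fun s => ψ x s) t
      - deriv φ (θ x t) * ((γt x t : ℂ) + ((deriv σ t : ℝ) : ℂ) / (N : ℂ)) := by
    rw [hvt]
    refine ((hψt x t ht).hasDerivAt.sub
      ((hφ (θ x t)).hasDerivAt.scomp t hθt)).deriv.trans ?_
    rw [Complex.real_smul]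
    push_cast
    ring
  have hv_xx : deriv (deriv fun y => vm y t) x = deriv (deriv fun y => ψ y t) x
      - (deriv (deriv φ) (θ x t) * (1 + (γx x t : ℂ)) ^ 2
        + deriv φ (θ x t) * (γxx x t : ℂ)) := by
    have hv_x : (deriv fun y => vm y t)
        = fun y => deriv (fun y => ψ y t) y - deriv (fun y => φ (θ y t)) y := by
      rw [hvx]
      funext y
      exact deriv_fun_sub (hψx t ht y) ((hφ (θ y t)).comp y (hθ_diff y))
    rw [hv_x]
    refine ((hψxx t ht x).hasDerivAt.sub
      (hasDerivAt_deriv_comp_real hφ hφ' hθ_diff hθ_diff' x)).deriv.trans ?_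
    rw [hθ_deriv, deriv_const_add, hγx', hγxx']
    push_cast
    rfl
  have hψ : ψ x t = φm x t + vm x t := by
    rw [hvm]
    ring
  have hp := hprofile (θ x t)
  rw [← hφm] at hp
  have hcubic := normSq_mul_self_add (φm x t) (vm x t)
  rw [hv_t, hLLE x t ht, hv_xx, hψ]
  linear_combination hp + I * hcubic
end

section
/- Let T > 0, m > 0, r₀ > 0, and let φ : ℝ → ℂ be a T-periodic function of class C³ with |φ'(x)| + |φ''(x)| + |φ'''(x)| ≤ m for all x. Then there exists a constant C > 0, depending only on T, m and r₀ (in particular independent of N), such that the following holds for every N ∈ ℕ (with L = NT): for every L-periodic ψ : ℝ → ℂ of class C², every L-periodic γ : ℝ → ℝ of class C³ with ‖γ‖_{H³(0,L)} ≤ r₀ and ‖γ'‖_{L^∞} ≤ 1/2, and every σ ∈ ℝ with |σ| ≤ r₀, the inverse-modulated perturbation v(x) = ψ(x - γ(x) - σ/N) - φ(x) and the forward-modulated perturbation ∘v(x) = ψ(x) - φ(x + γ(x) + σ/N) satisfy ‖v‖_{H²(0,L)} ≤ C(‖∘v‖_{H²(0,L)} + ‖γ'‖_{H¹(0,L)})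 and ‖∘v‖_{L²(0,L)} ≤ C(‖v‖_{L²(0,L)} + ‖γ'‖_{H¹(0,L)}). -/
/-- The `L²`-norm over one period `(0, L)`. -/
noncomputable def L2norm {E : Type*} [NormedAddCommGroup E] (L : ℝ) (f : ℝ → E) : ℝ :=
  Real.sqrt (∫ x in (0:ℝ)..L, ‖f x‖ ^ 2)

/-- The `H¹`-norm over one period `(0, L)`. -/
noncomputable def H1norm {E : Type*} [NormedAddCommGroup E] [NormedSpace ℝ E]
    (L : ℝ) (f : ℝ → E) : ℝ :=
  Real.sqrt ((∫ x in (0:ℝ)..L, ‖f x‖ ^ 2) + ∫ x in (0:ℝ)..L, ‖deriv f x‖ ^ 2)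

/-- The `H²`-norm over one period `(0, L)`. -/
noncomputable def H2norm {E : Type*} [NormedAddCommGroup E] [NormedSpace ℝ E]
    (L : ℝ) (f : ℝ → E) : ℝ :=
  Real.sqrt ((∫ x in (0:ℝ)..L, ‖f x‖ ^ 2) + (∫ x in (0:ℝ)..L, ‖deriv f x‖ ^ 2)
    + ∫ x in (0:ℝ)..L, ‖deriv (deriv f) x‖ ^ 2)

/-- The `H³`-norm over one period `(0, L)`. -/
noncomputable def H3norm {E : Type*} [NormedAddCommGroup E] [NormedSpace ℝ E]
    (L : ℝ) (f : ℝ → E) : ℝ :=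
  Real.sqrt ((∫ x in (0:ℝ)..L, ‖f x‖ ^ 2) + (∫ x in (0:ℝ)..L, ‖deriv f x‖ ^ 2)
    + (∫ x in (0:ℝ)..L, ‖deriv (deriv f) x‖ ^ 2)
    + ∫ x in (0:ℝ)..L, ‖deriv (deriv (deriv f)) x‖ ^ 2)

open MeasureTheory intervalIntegral Set

/-- Integral over a shorter interval of a nonnegative periodic function. -/
lemma integral_le_integral_period {g : ℝ → ℝ} {L x y : ℝ} (hg : Continuous g)
    (hp : Function.Periodic g L) (h0 : ∀ t, 0 ≤ g t) (hxy : x ≤ y) (hy : y ≤ x + L) :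
    ∫ t in x..y, g t ≤ ∫ t in (0:ℝ)..L, g t := by
  have h1 : ∫ t in x..x + L, g t = ∫ t in (0:ℝ)..L, g t := by
    simpa using hp.intervalIntegral_add_eq x 0
  rw [← h1]
  exact integral_mono_interval le_rfl hxy hy (Filter.Eventually.of_forall h0)
    (hg.intervalIntegrable _ _)

/-- Sobolev embedding `H¹ ⊂ L^∞` on a circle of length at least `T`, uniformly in the length. -/
lemma sq_le_of_periodic {f f' : ℝ → ℝ} {L T : ℝ} (hT : 0 < T) (hTL : T ≤ L)
    (hf : ∀ x, HasDerivAt f (f' x) x) (hf' : Continuous f') (hp : Function.Periodic f L)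
    (hp' : Function.Periodic f' L) (x : ℝ) :
    f x ^ 2 ≤ (1 / T + 1) * ((∫ t in (0:ℝ)..L, f t ^ 2) + ∫ t in (0:ℝ)..L, f' t ^ 2) := by
  have hc : Continuous f := continuous_iff_continuousAt.2 fun x => (hf x).continuousAt
  set I := (∫ t in (0:ℝ)..L, f t ^ 2) + ∫ t in (0:ℝ)..L, f' t ^ 2 with hI
  have hL : 0 ≤ L := hT.le.trans hTL
  have hI0 : 0 ≤ ∫ t in (0:ℝ)..L, f' t ^ 2 := integral_nonneg hL fun t _ => sq_nonneg _
  have hIe : ∫ t in (0:ℝ)..L, (f t ^ 2 + f' t ^ 2) = I :=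
    integral_add ((hc.pow 2).intervalIntegrable _ _) ((hf'.pow 2).intervalIntegrable _ _)
  have key : ∀ y ∈ Icc x (x + T), f x ^ 2 ≤ f y ^ 2 + I := by
    intro y hy
    have h1 : ∫ t in x..y, 2 * f t * f' t = f y ^ 2 - f x ^ 2 := by
      refine integral_eq_sub_of_hasDerivAt (f := fun t => f t ^ 2) (fun t _ => ?_) ?_
      · exact ((hf t).pow 2).congr_deriv (by simp)
      · exact ((continuous_const.mul hc).mul hf').intervalIntegrable _ _
    have h2 : ∫ t in x..y, (-(2 * f t * f' t)) ≤ ∫ t in x..y, (f t ^ 2 + f' t ^ 2) := by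
      refine integral_mono_on hy.1 ?_ ?_ fun t _ => by nlinarith [sq_nonneg (f t + f' t)]
      · exact ((continuous_const.mul hc).mul hf').neg.intervalIntegrable _ _
      · exact ((hc.pow 2).add (hf'.pow 2)).intervalIntegrable _ _
    have h3 : ∫ t in x..y, (f t ^ 2 + f' t ^ 2) ≤ I := by
      rw [← hIe]
      refine integral_le_integral_period ((hc.pow 2).add (hf'.pow 2)) (fun t => ?_)
        (fun t => by positivity) hy.1 (by linarith [hy.2])
      simp [hp t, hp' t]
    rw [intervalIntegral.integral_neg, h1] at h2
    linarith
  have h4 : ∫ y in x..x + T, f x ^ 2 ≤ ∫ y in x..x + T, (f y ^ 2 + I) :=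
    integral_mono_on (by linarith) (by simp)
      (((hc.pow 2).add continuous_const).intervalIntegrable _ _)
      key
  have hi : Continuous fun y => f y ^ 2 := hc.pow 2
  rw [intervalIntegral.integral_add (hi.intervalIntegrable _ _) (by simp)] at h4
  simp only [intervalIntegral.integral_const, add_sub_cancel_left, smul_eq_mul] at h4
  have h5 : ∫ y in x..x + T, f y ^ 2 ≤ ∫ t in (0:ℝ)..L, f t ^ 2 :=
    integral_le_integral_period (hc.pow 2) (fun t => by simp [hp t])
      (fun t => sq_nonneg _) (by linarith) (by linarith)
  have h6 : T * f x ^ 2 ≤ T * ((1 / T + 1) * I) := by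
    have : T * ((1 / T + 1) * I) = I + T * I := by field_simp
    rw [this]; linarith
  exact le_of_mul_le_mul_left h6 hT

/-- Change of variables for a degree-one circle map: the factor `A'` integrates out. -/
lemma integral_comp_mul_deriv_period {A A' g : ℝ → ℝ} {L : ℝ} (hA : ∀ x, HasDerivAt A (A' x) x)
    (hA' : Continuous A') (hAL : A L = A 0 + L) (hg : Continuous g)
    (hp : Function.Periodic g L) :
    ∫ x in (0:ℝ)..L, g (A x) * A' x = ∫ x in (0:ℝ)..L, g x := by
  have h := integral_comp_mul_deriv (a := 0) (b := L) (fun x _ => hA x) hA'.continuousOn hg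
  simp only [Function.comp_apply] at h
  rw [h, hAL]
  simpa using hp.intervalIntegral_add_eq (A 0) 0

lemma integral_comp_le_two_mul {A A' g : ℝ → ℝ} {L : ℝ} (hL : 0 ≤ L)
    (hA : ∀ x, HasDerivAt A (A' x) x) (hA' : Continuous A') (hAL : A L = A 0 + L)
    (hlb : ∀ x, 1 / 2 ≤ A' x) (hg : Continuous g) (hp : Function.Periodic g L)
    (h0 : ∀ x, 0 ≤ g x) :
    ∫ x in (0:ℝ)..L, g (A x) ≤ 2 * ∫ x in (0:ℝ)..L, g x := by
  have hc : Continuous A := continuous_iff_continuousAt.2 fun x => (hA x).continuousAt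
  rw [← integral_comp_mul_deriv_period hA hA' hAL hg hp, ← intervalIntegral.integral_const_mul]
  refine integral_mono_on hL ((hg.comp hc).intervalIntegrable _ _)
    ((continuous_const.mul ((hg.comp hc).mul hA')).intervalIntegrable _ _) fun x _ => ?_
  nlinarith [h0 (A x), hlb x]

lemma integral_le_two_mul_comp {A A' g : ℝ → ℝ} {L : ℝ} (hL : 0 ≤ L)
    (hA : ∀ x, HasDerivAt A (A' x) x) (hA' : Continuous A') (hAL : A L = A 0 + L)
    (hub : ∀ x, A' x ≤ 2) (hg : Continuous g) (hp : Function.Periodic g L)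
    (h0 : ∀ x, 0 ≤ g x) :
    ∫ x in (0:ℝ)..L, g x ≤ 2 * ∫ x in (0:ℝ)..L, g (A x) := by
  have hc : Continuous A := continuous_iff_continuousAt.2 fun x => (hA x).continuousAt
  rw [← integral_comp_mul_deriv_period hA hA' hAL hg hp, ← intervalIntegral.integral_const_mul]
  refine integral_mono_on hL (((hg.comp hc).mul hA').intervalIntegrable _ _)
    ((continuous_const.mul (hg.comp hc)).intervalIntegrable _ _) fun x _ => ?_
  nlinarith [h0 (A x), hub x]

/-- Hölder-`1/2` estimate for a function with square-integrable derivative. -/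
lemma sub_sq_le_mul_integral {f f' : ℝ → ℝ} (hf : ∀ x, HasDerivAt f (f' x) x)
    (hf' : Continuous f') {a b : ℝ} (hab : a ≤ b) :
    (f b - f a) ^ 2 ≤ (b - a) * ∫ t in a..b, f' t ^ 2 := by
  have h1 : ∫ t in a..b, f' t = f b - f a :=
    integral_eq_sub_of_hasDerivAt (fun t _ => hf t) (hf'.intervalIntegrable _ _)
  set d := f b - f a
  have h2 : 0 ≤ ∫ t in a..b, ((b - a) * f' t - d) ^ 2 :=
    integral_nonneg hab fun t _ => sq_nonneg _
  have h3 : ∫ t in a..b, ((b - a) * f' t - d) ^ 2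
      = (b - a) * ((b - a) * (∫ t in a..b, f' t ^ 2) - d ^ 2) := by
    have : ∀ t, ((b - a) * f' t - d) ^ 2
        = ((b - a) ^ 2 * f' t ^ 2 - 2 * (b - a) * d * f' t) + d ^ 2 := fun t => by ring
    simp_rw [this]
    rw [intervalIntegral.integral_add, intervalIntegral.integral_sub]
    · simp only [intervalIntegral.integral_const_mul, intervalIntegral.integral_const, h1,
        smul_eq_mul]
      ring
    all_goals exact Continuous.intervalIntegrable (by fun_prop) _ _
  rcases hab.eq_or_lt with rfl | h
  · simp [d]
  · rw [h3] at h2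
    linarith [nonneg_of_mul_nonneg_right h2 (sub_pos.2 h)]

/-- `L²`-estimate for the increment of a periodic function under a bounded displacement. -/
lemma integral_comp_sub_sq_le {f f' A : ℝ → ℝ} {L K : ℝ} (hL : 0 ≤ L)
    (hf : ∀ x, HasDerivAt f (f' x) x) (hf' : Continuous f') (hp' : Function.Periodic f' L)
    (hA : Continuous A) (hK : ∀ x, |A x - x| ≤ K) :
    ∫ x in (0:ℝ)..L, (f (A x) - f x) ^ 2 ≤ 2 * K ^ 2 * ∫ x in (0:ℝ)..L, f' x ^ 2 := by
  have hc : Continuous f := continuous_iff_continuousAt.2 fun x => (hf x).continuousAt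
  have hK0 : 0 ≤ K := (abs_nonneg _).trans (hK 0)
  have hu : Continuous (Function.uncurry fun x s : ℝ => f' (x + s) ^ 2) :=
    (hf'.comp (continuous_fst.add continuous_snd)).pow 2
  have hpt : ∀ x, (f (A x) - f x) ^ 2 ≤ K * ∫ s in -K..K, f' (x + s) ^ 2 := by
    intro x
    have hb := abs_le.1 (hK x)
    have hshift : ∫ s in -K..K, f' (x + s) ^ 2 = ∫ t in x + -K..x + K, f' t ^ 2 :=
      integral_comp_add_left (fun t => f' t ^ 2) x
    have hmono : ∀ a b : ℝ, x + -K ≤ a → a ≤ b → b ≤ x + K →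
        ∫ t in a..b, f' t ^ 2 ≤ ∫ t in x + -K..x + K, f' t ^ 2 := fun a b h1 h2 h3 =>
      integral_mono_interval h1 h2 h3 (Filter.Eventually.of_forall fun t => sq_nonneg _)
        ((hf'.pow 2).intervalIntegrable _ _)
    rw [hshift]
    rcases le_total x (A x) with h | h
    · refine (sub_sq_le_mul_integral hf hf' h).trans ?_
      exact mul_le_mul (by linarith) (hmono _ _ (by linarith) h (by linarith))
        (integral_nonneg h fun t _ => sq_nonneg _) hK0
    · rw [← neg_sub, neg_sq]
      refine (sub_sq_le_mul_integral hf hf' h).trans ?_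
      exact mul_le_mul (by linarith) (hmono _ _ (by linarith) h (by linarith))
        (integral_nonneg h fun t _ => sq_nonneg _) hK0
  have hci : Continuous fun x => ∫ s in -K..K, f' (x + s) ^ 2 :=
    continuous_parametric_intervalIntegral_of_continuous' hu _ _
  calc ∫ x in (0:ℝ)..L, (f (A x) - f x) ^ 2
      ≤ ∫ x in (0:ℝ)..L, K * ∫ s in -K..K, f' (x + s) ^ 2 :=
        integral_mono_on hL ((((hc.comp hA).sub hc).pow 2).intervalIntegrable _ _)
          ((continuous_const.mul hci).intervalIntegrable _ _) fun x _ => hpt x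
    _ = K * ∫ s in -K..K, ∫ x in (0:ℝ)..L, f' (x + s) ^ 2 := by
        rw [intervalIntegral.integral_const_mul, intervalIntegral_intervalIntegral_swap]
        exact (hu.continuousOn.integrableOn_compact
          (isCompact_uIcc.prod isCompact_uIcc)).mono_set
            (prod_mono uIoc_subset_uIcc uIoc_subset_uIcc)
    _ = K * ∫ s in -K..K, ∫ x in (0:ℝ)..L, f' x ^ 2 := by
        congr 2
        ext s
        rw [integral_comp_add_right (fun t => f' t ^ 2) s]
        have hp2 : Function.Periodic (fun t => f' t ^ 2) L := fun t => by simp [hp' t]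
        simpa [add_comm] using hp2.intervalIntegral_add_eq s 0
    _ = 2 * K ^ 2 * ∫ x in (0:ℝ)..L, f' x ^ 2 := by
        rw [intervalIntegral.integral_const, smul_eq_mul]; ring

lemma sqrt_le_mul_sqrt_add_sqrt {X a b c C : ℝ} (hC : c ≤ C ^ 2) (hC0 : 0 ≤ C)
    (ha : 0 ≤ a) (hb : 0 ≤ b) (h : X ≤ c * (a + b)) :
    √X ≤ C * (√a + √b) := by
  refine Real.sqrt_le_iff.2 ⟨by positivity, h.trans ?_⟩
  rw [mul_pow]
  refine mul_le_mul hC ?_ (by positivity) (by positivity)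
  nlinarith [Real.sq_sqrt ha, Real.sq_sqrt hb, Real.sqrt_nonneg a, Real.sqrt_nonneg b,
    mul_nonneg (Real.sqrt_nonneg a) (Real.sqrt_nonneg b)]

lemma periodic_deriv {E : Type*} [NormedAddCommGroup E] [NormedSpace ℝ E] {f : ℝ → E} {L : ℝ}
    (hp : Function.Periodic f L) : Function.Periodic (deriv f) L := by
  intro x
  rw [← deriv_comp_add_const f L x]
  exact congrArg (fun g => deriv g x) (funext hp)

lemma abs_one_sub_mul_one_add_sub_one_le {p q : ℝ} (hp : |p| ≤ 1 / 2) :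
    |(1 - q) * (1 + p) - 1| ≤ 3 / 2 * (|p| + |q|) := by
  have h : (1 - q) * (1 + p) - 1 = p - q * (1 + p) := by ring
  have h1 : |1 + p| ≤ 3 / 2 := by
    have := abs_add_le 1 p
    rw [abs_one] at this
    linarith
  calc |(1 - q) * (1 + p) - 1| ≤ |p| + |q| * |1 + p| := by
        rw [h, ← abs_mul]; exact abs_sub _ _
    _ ≤ _ := by nlinarith [abs_nonneg p, abs_nonneg q]

lemma abs_sq_one_sub_mul_sq_one_add_sub_one_le {p q : ℝ} (hp : |p| ≤ 1 / 2) (hq : |q| ≤ 1 / 2) :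
    |(1 - q) ^ 2 * (1 + p) ^ 2 - 1| ≤ 5 * (|p| + |q|) := by
  have h : (1 - q) ^ 2 * (1 + p) ^ 2 - 1
      = ((1 - q) * (1 + p) - 1) * ((1 - q) * (1 + p) + 1) := by ring
  have hp' := abs_le.1 hp
  have hq' := abs_le.1 hq
  have h1 : |(1 - q) * (1 + p) + 1| ≤ 13 / 4 := by
    rw [abs_le]; constructor <;> nlinarith
  rw [h, abs_mul]
  calc _ ≤ 3 / 2 * (|p| + |q|) * (13 / 4) :=
        mul_le_mul (abs_one_sub_mul_one_add_sub_one_le hp) h1 (abs_nonneg _) (by positivity)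
    _ ≤ _ := by nlinarith [abs_nonneg p, abs_nonneg q]

section Pointwise

variable {E : Type*} [NormedAddCommGroup E] [NormedSpace ℝ E]

/-- Pointwise bound for the first derivative of the inverse-modulated perturbation. -/
lemma norm_first_deriv_le {w₁ a b : E} {m d p q : ℝ} (hp : |p| ≤ 1 / 2) (hq : |q| ≤ 1 / 2)
    (ha : ‖a‖ ≤ m) (hab : ‖a - b‖ ≤ m * d) :
    ‖(1 - q) • (w₁ + (1 + p) • a) - b‖ ≤ 3 / 2 * ‖w₁‖ + m * d + 3 / 2 * m * (|p| + |q|) := by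
  have h : (1 - q) • (w₁ + (1 + p) • a) - b
      = (1 - q) • w₁ + (a - b) + ((1 - q) * (1 + p) - 1) • a := by module
  have h1 : |1 - q| ≤ 3 / 2 := by
    have := abs_le.1 hq
    rw [abs_le]; constructor <;> linarith
  rw [h]
  refine norm_add₃_le.trans ?_
  rw [norm_smul, norm_smul, Real.norm_eq_abs, Real.norm_eq_abs]
  have h2 := mul_le_mul_of_nonneg_right h1 (norm_nonneg w₁)
  have h3 := mul_le_mul (abs_one_sub_mul_one_add_sub_one_le (q := q) hp) ha (norm_nonneg a)
    (by positivity)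
  linarith

/-- Pointwise bound for the second derivative of the inverse-modulated perturbation. -/
lemma norm_second_deriv_le {w₁ w₂ a b c : E} {m d p q r s G : ℝ} (hp : |p| ≤ 1 / 2)
    (hq : |q| ≤ 1 / 2) (hs : |s| ≤ G) (ha : ‖a‖ ≤ m) (hb : ‖b‖ ≤ m) (hbc : ‖b - c‖ ≤ m * d) :
    ‖(1 - q) • (1 - q) • (w₂ + ((1 + p) • (1 + p) • b + r • a)) - s • (w₁ + (1 + p) • a) - c‖ ≤
      9 / 4 * ‖w₂‖ + G * ‖w₁‖ + m * d + 5 * m * (|p| + |q|) + 9 / 4 * m * |r|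
        + 3 / 2 * m * |s| := by
  have h : (1 - q) • (1 - q) • (w₂ + ((1 + p) • (1 + p) • b + r • a)) - s • (w₁ + (1 + p) • a) - c
      = (((1 - q) ^ 2 • w₂ + (b - c) + ((1 - q) ^ 2 * (1 + p) ^ 2 - 1) • b)
        + ((1 - q) ^ 2 • r • a)) + ((-s) • w₁ + (-s) • (1 + p) • a) := by module
  have h1 : |(1 - q) ^ 2| ≤ 9 / 4 := by
    have := abs_le.1 hq
    rw [abs_le]; constructor <;> nlinarith
  have h2 : |1 + p| ≤ 3 / 2 := by
    have := abs_le.1 hp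
    rw [abs_le]; constructor <;> linarith
  have hm : 0 ≤ m := (norm_nonneg a).trans ha
  rw [h]
  refine (norm_add_le_of_le (norm_add_le_of_le norm_add₃_le le_rfl) (norm_add_le _ _)).trans ?_
  simp only [norm_smul, Real.norm_eq_abs, abs_neg]
  have e1 := mul_le_mul_of_nonneg_right h1 (norm_nonneg w₂)
  have e2 := mul_le_mul_of_nonneg_right hs (norm_nonneg w₁)
  have e3 := mul_le_mul (abs_sq_one_sub_mul_sq_one_add_sub_one_le hp hq) hb (norm_nonneg b)
    (by positivity)
  have e4 := mul_le_mul h1 (mul_le_mul_of_nonneg_left ha (abs_nonneg r)) (by positivity)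
    (by positivity)
  have e5 := mul_le_mul_of_nonneg_left (mul_le_mul h2 ha (norm_nonneg a) (by norm_num))
    (abs_nonneg s)
  linarith

end Pointwise

lemma sq_le_of_le_mul_sum {u M a b c d p q r s : ℝ} (hu : 0 ≤ u)
    (h : u ≤ M * (a + b + c + d + p + q + r + s)) :
    u ^ 2 ≤ 8 * M ^ 2 * (a ^ 2 + b ^ 2 + c ^ 2 + d ^ 2 + p ^ 2 + q ^ 2 + r ^ 2 + s ^ 2) := by
  have h1 : (a + b + c + d + p + q + r + s) ^ 2
      ≤ 8 * (a ^ 2 + b ^ 2 + c ^ 2 + d ^ 2 + p ^ 2 + q ^ 2 + r ^ 2 + s ^ 2) := by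
    have h2 := sq_sum_le_card_mul_sum_sq (s := Finset.univ) (f := ![a, b, c, d, p, q, r, s])
    simp [Fin.sum_univ_succ] at h2
    linarith
  calc u ^ 2 ≤ (M * (a + b + c + d + p + q + r + s)) ^ 2 := pow_le_pow_left₀ hu h 2
    _ ≤ _ := by rw [mul_pow]; nlinarith [mul_le_mul_of_nonneg_left h1 (sq_nonneg M)]

/-- The pointwise estimates for the inverse-modulated perturbation, summed up and squared. -/
lemma sum_sq_deriv_le {E : Type*} [NormedAddCommGroup E] [NormedSpace ℝ E]
    {w₀ w₁ w₂ a₀ b₀ a b c e : E} {m d p q r s G : ℝ} (hG : 0 ≤ G) (hd : 0 ≤ d)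
    (hp : |p| ≤ 1 / 2) (hq : |q| ≤ 1 / 2) (hs : |s| ≤ G) (ha : ‖a‖ ≤ m) (hb : ‖b‖ ≤ m)
    (h₀ : ‖a₀ - b₀‖ ≤ m * d) (h₁ : ‖a - e‖ ≤ m * d) (h₂ : ‖b - c‖ ≤ m * d) :
    ‖w₀ + a₀ - b₀‖ ^ 2 + ‖(1 - q) • (w₁ + (1 + p) • a) - e‖ ^ 2 +
      ‖(1 - q) • (1 - q) • (w₂ + ((1 + p) • (1 + p) • b + r • a)) -
        s • (w₁ + (1 + p) • a) - c‖ ^ 2 ≤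
      24 * (9 / 4 + G + 5 * m) ^ 2 *
        ((‖w₀‖ ^ 2 + ‖w₁‖ ^ 2 + ‖w₂‖ ^ 2 + (p ^ 2 + r ^ 2)) + (q ^ 2 + s ^ 2) + d ^ 2) := by
  have hm : 0 ≤ m := (norm_nonneg a).trans ha
  set M := 9 / 4 + G + 5 * m with hM
  have n0 := norm_nonneg w₀
  have n1 := norm_nonneg w₁
  have n2 := norm_nonneg w₂
  have np := abs_nonneg p
  have nq := abs_nonneg q
  have nr := abs_nonneg r
  have ns := abs_nonneg s
  have le_M : ∀ {k x : ℝ}, k ≤ M → 0 ≤ x → k * x ≤ M * x := fun h hx =>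
    mul_le_mul_of_nonneg_right h hx
  have hM1 : 9 / 4 ≤ M := by linarith
  have hM2 : 5 * m ≤ M := by linarith
  have hM3 : G ≤ M := by linarith
  have hM0 : 0 ≤ M := by linarith
  have e0 : ‖w₀ + a₀ - b₀‖ ≤
      M * (‖w₀‖ + ‖w₁‖ + ‖w₂‖ + d + |p| + |q| + |r| + |s|) := by
    have h : ‖w₀ + a₀ - b₀‖ ≤ ‖w₀‖ + ‖a₀ - b₀‖ := by rw [add_sub_assoc]; exact norm_add_le _ _
    have k0 := le_M hM1 n0
    have kd := le_M (k := m) (by linarith) hd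
    have : 0 ≤ M * (‖w₁‖ + ‖w₂‖ + |p| + |q| + |r| + |s|) := by positivity
    linarith
  have e1 : ‖(1 - q) • (w₁ + (1 + p) • a) - e‖ ≤
      M * (‖w₀‖ + ‖w₁‖ + ‖w₂‖ + d + |p| + |q| + |r| + |s|) := by
    have h := norm_first_deriv_le (w₁ := w₁) hp hq ha h₁
    have k1 := le_M (k := 3 / 2) (by linarith) n1
    have kd := le_M (k := m) (by linarith) hd
    have kp := le_M (k := 3 / 2 * m) (by linarith) np
    have kq := le_M (k := 3 / 2 * m) (by linarith) nq
    have : 0 ≤ M * (‖w₀‖ + ‖w₂‖ + |r| + |s|) := by positivity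
    linarith
  have e2 : ‖(1 - q) • (1 - q) • (w₂ + ((1 + p) • (1 + p) • b + r • a)) -
      s • (w₁ + (1 + p) • a) - c‖ ≤
      M * (‖w₀‖ + ‖w₁‖ + ‖w₂‖ + d + |p| + |q| + |r| + |s|) := by
    have h := norm_second_deriv_le (w₁ := w₁) (w₂ := w₂) (r := r) hp hq hs ha hb h₂
    have k1 := le_M hM3 n1
    have k2 := le_M hM1 n2
    have kd := le_M (k := m) (by linarith) hd
    have kp := le_M hM2 np
    have kq := le_M hM2 nq
    have kr := le_M (k := 9 / 4 * m) (by linarith) nr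
    have ks := le_M (k := 3 / 2 * m) (by linarith) ns
    have : 0 ≤ M * ‖w₀‖ := by positivity
    linarith
  have f0 := sq_le_of_le_mul_sum (norm_nonneg _) e0
  have f1 := sq_le_of_le_mul_sum (norm_nonneg _) e1
  have f2 := sq_le_of_le_mul_sum (norm_nonneg _) e2
  simp only [sq_abs] at f0 f1 f2
  linarith

lemma norm_sub_le_of_norm_deriv_le {E : Type*} [NormedAddCommGroup E] [NormedSpace ℝ E]
    {f : ℝ → E} {m : ℝ} (hf : Differentiable ℝ f) (hm : ∀ x, ‖deriv f x‖ ≤ m) (x y : ℝ) :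
    ‖f y - f x‖ ≤ m * |y - x| :=
  convex_univ.norm_image_sub_le_of_norm_deriv_le (fun z _ => hf z) (fun z _ => hm z)
    (mem_univ x) (mem_univ y)

set_option maxHeartbeats 400000 in
/-- N-uniform equivalence of the inverse-modulated perturbation
`v(x) = ψ(x - γ(x) - σ/N) - φ(x)` and the forward-modulated perturbation
`∘v(x) = ψ(x) - φ(x + γ(x) + σ/N)`:
`‖v‖_{H²} ≤ C(‖∘v‖_{H²} + ‖γ'‖_{H¹})` and `‖∘v‖_{L²} ≤ C(‖v‖_{L²} + ‖γ'‖_{H¹})`,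
with `C` depending only on `T`, `m` and `r₀`. -/
theorem modulated_perturbations_norm_equivalence
    (T m r₀ : ℝ) (hT : 0 < T) (hm : 0 < m) (hr₀ : 0 < r₀) :
    ∃ C : ℝ, 0 < C ∧
      ∀ φ : ℝ → ℂ, ContDiff ℝ 3 φ → Function.Periodic φ T →
      (∀ x : ℝ, ‖deriv φ x‖ + ‖deriv (deriv φ) x‖ + ‖deriv (deriv (deriv φ)) x‖ ≤ m) →
      ∀ N : ℕ, 0 < N →
      ∀ (ψ : ℝ → ℂ) (γ : ℝ → ℝ) (σ : ℝ),
      ContDiff ℝ 2 ψ → Function.Periodic ψ (N * T) →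
      ContDiff ℝ 3 γ → Function.Periodic γ (N * T) →
      H3norm (N * T) γ ≤ r₀ → (∀ x : ℝ, |deriv γ x| ≤ 1 / 2) → |σ| ≤ r₀ →
      ∀ v w : ℝ → ℂ,
      (∀ x : ℝ, v x = ψ (x - γ x - σ / N) - φ x) →
      (∀ x : ℝ, w x = ψ x - φ (x + γ x + σ / N)) →
      H2norm (N * T) v ≤ C * (H2norm (N * T) w + H1norm (N * T) (deriv γ)) ∧
      L2norm (N * T) w ≤ C * (L2norm (N * T) v + H1norm (N * T) (deriv γ)) := by
  set G : ℝ := √((1 / T + 1) * r₀ ^ 2)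
  have hG : 0 ≤ G := Real.sqrt_nonneg _
  set K : ℝ := G + r₀
  set c₁ : ℝ := 24 * (9 / 4 + G + 5 * m) ^ 2 * (2 * K ^ 2 + 3)
  set c₂ : ℝ := 4 + 8 * m ^ 2 * K ^ 2
  have hc₁ : 0 ≤ c₁ := by positivity
  have hc₂ : 0 ≤ c₂ := by positivity
  have hC : ∀ {c : ℝ}, c ≤ 1 + c₁ + c₂ → c ≤ (1 + c₁ + c₂) ^ 2 := fun h =>
    h.trans (le_self_pow₀ (by linarith) two_ne_zero)
  refine ⟨1 + c₁ + c₂, by positivity, ?_⟩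
  intro φ hφ hφp hφm N hN ψ γ σ hψ hψp hγ hγp hγr hγ' hσ v w hv hw
  have hN1 : (1:ℝ) ≤ N := by exact_mod_cast hN
  set L : ℝ := N * T
  have hTL : T ≤ L := le_mul_of_one_le_left hT.le hN1
  have hL : 0 ≤ L := hT.le.trans hTL
  set a : ℝ := σ / N
  have ha : |a| ≤ r₀ := by
    rw [abs_div, Nat.abs_cast]
    exact (div_le_self (abs_nonneg _) hN1).trans hσ
  have hφL : Function.Periodic φ L := hφp.nat_mul N
  -- Derivatives of the data.
  have dφ : ContDiff ℝ 2 (deriv φ) := (contDiff_succ_iff_deriv.1 hφ).2.2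
  have ddφ : ContDiff ℝ 1 (deriv (deriv φ)) := (contDiff_succ_iff_deriv.1 dφ).2.2
  have dψ : ContDiff ℝ 1 (deriv ψ) := (contDiff_succ_iff_deriv.1 hψ).2.2
  have ddψ : Continuous (deriv (deriv ψ)) := dψ.continuous_deriv le_rfl
  have dγ : ContDiff ℝ 2 (deriv γ) := (contDiff_succ_iff_deriv.1 hγ).2.2
  have ddγ : ContDiff ℝ 1 (deriv (deriv γ)) := (contDiff_succ_iff_deriv.1 dγ).2.2
  have dddγ : Continuous (deriv (deriv (deriv γ))) := ddγ.continuous_deriv le_rfl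
  have Hφ : ∀ x, HasDerivAt φ (deriv φ x) x := fun x =>
    (hφ.differentiable (by norm_num) x).hasDerivAt
  have Hdφ : ∀ x, HasDerivAt (deriv φ) (deriv (deriv φ) x) x := fun x =>
    (dφ.differentiable (by norm_num) x).hasDerivAt
  have Hψ : ∀ x, HasDerivAt ψ (deriv ψ x) x := fun x =>
    (hψ.differentiable (by norm_num) x).hasDerivAt
  have Hdψ : ∀ x, HasDerivAt (deriv ψ) (deriv (deriv ψ) x) x := fun x =>
    (dψ.differentiable (by norm_num) x).hasDerivAt
  have Hγ : ∀ x, HasDerivAt γ (deriv γ x) x := fun x =>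
    (hγ.differentiable (by norm_num) x).hasDerivAt
  have Hdγ : ∀ x, HasDerivAt (deriv γ) (deriv (deriv γ) x) x := fun x =>
    (dγ.differentiable (by norm_num) x).hasDerivAt
  have Hddγ : ∀ x, HasDerivAt (deriv (deriv γ)) (deriv (deriv (deriv γ)) x) x := fun x =>
    (ddγ.differentiable (by norm_num) x).hasDerivAt
  have cφ := hφ.continuous
  have cdφ := dφ.continuous
  have cddφ := ddφ.continuous
  have cψ := hψ.continuous
  have cdψ := dψ.continuous
  have cγ := hγ.continuous
  have cdγ := dγ.continuous
  have cddγ := ddγ.continuous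
  have pdγ : Function.Periodic (deriv γ) L := periodic_deriv hγp
  have pddγ : Function.Periodic (deriv (deriv γ)) L := periodic_deriv pdγ
  have pdddγ : Function.Periodic (deriv (deriv (deriv γ))) L := periodic_deriv pddγ
  have bφ₁ : ∀ x, ‖deriv φ x‖ ≤ m := fun x => by
    linarith [hφm x, norm_nonneg (deriv (deriv φ) x), norm_nonneg (deriv (deriv (deriv φ)) x)]
  have bφ₂ : ∀ x, ‖deriv (deriv φ) x‖ ≤ m := fun x => by
    linarith [hφm x, norm_nonneg (deriv φ x), norm_nonneg (deriv (deriv (deriv φ)) x)]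
  have bφ₃ : ∀ x, ‖deriv (deriv (deriv φ)) x‖ ≤ m := fun x => by
    linarith [hφm x, norm_nonneg (deriv φ x), norm_nonneg (deriv (deriv φ) x)]
  -- Uniform bounds for `γ` and its second derivative.
  have I0 : 0 ≤ ∫ x in (0:ℝ)..L, γ x ^ 2 := integral_nonneg hL fun _ _ => sq_nonneg _
  have I1 : 0 ≤ ∫ x in (0:ℝ)..L, deriv γ x ^ 2 := integral_nonneg hL fun _ _ => sq_nonneg _
  have I2 : 0 ≤ ∫ x in (0:ℝ)..L, deriv (deriv γ) x ^ 2 :=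
    integral_nonneg hL fun _ _ => sq_nonneg _
  have I3 : 0 ≤ ∫ x in (0:ℝ)..L, deriv (deriv (deriv γ)) x ^ 2 :=
    integral_nonneg hL fun _ _ => sq_nonneg _
  have hγr2 := (Real.sqrt_le_left hr₀.le).1 hγr
  simp only [Real.norm_eq_abs, sq_abs] at hγr2
  have bγ : ∀ x, |γ x| ≤ G := fun x => by
    refine Real.abs_le_sqrt ((sq_le_of_periodic hT hTL Hγ cdγ hγp pdγ x).trans ?_)
    exact mul_le_mul_of_nonneg_left (by linarith) (by positivity)
  have bγ₂ : ∀ x, |deriv (deriv γ) x| ≤ G := fun x => by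
    refine Real.abs_le_sqrt ((sq_le_of_periodic hT hTL Hddγ dddγ pddγ pdddγ x).trans ?_)
    exact mul_le_mul_of_nonneg_left (by linarith) (by positivity)
  -- The two modulation maps.
  set A : ℝ → ℝ := fun x => x - γ x - a with hAdef
  set B : ℝ → ℝ := fun x => x + γ x + a with hBdef
  have HA : ∀ x, HasDerivAt A (1 - deriv γ x) x := fun x =>
    ((hasDerivAt_id x).sub (Hγ x)).sub_const a
  have HB : ∀ x, HasDerivAt B (1 + deriv γ x) x := fun x =>
    ((hasDerivAt_id x).add (Hγ x)).add_const a
  have cA : Continuous A := by fun_prop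
  have cB : Continuous B := by fun_prop
  have cA' : Continuous fun x => 1 - deriv γ x := by fun_prop
  have hAL : A L = A 0 + L := by
    have := hγp 0
    simp only [zero_add] at this
    simp only [hAdef, this]; ring
  have hBA : ∀ x, B (A x) - x = γ (A x) - γ x := fun x => by simp only [hAdef, hBdef]; ring
  have hAK : ∀ x, |A x - x| ≤ K := fun x => by
    have h : A x - x = -(γ x + a) := by simp only [hAdef]; ring
    rw [h, abs_neg]
    exact (abs_add_le _ _).trans (add_le_add (bγ x) ha)
  have Dint := integral_comp_sub_sq_le hL Hγ cdγ pdγ cA hAK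
  -- Derivatives of the perturbations.
  have dv : deriv v = fun x => (1 - deriv γ x) • deriv ψ (A x) - deriv φ x := by
    rw [funext hv]
    exact funext fun x => (((Hψ (A x)).scomp x (HA x)).sub (Hφ x)).deriv
  have ddv : deriv (deriv v) = fun x => (1 - deriv γ x) • (1 - deriv γ x) • deriv (deriv ψ) (A x)
      - deriv (deriv γ) x • deriv ψ (A x) - deriv (deriv φ) x := by
    rw [dv]
    refine funext fun x => ((((Hdγ x).const_sub 1).smul
      ((Hdψ (A x)).scomp x (HA x))).sub (Hdφ x)).deriv.trans ?_
    rw [neg_smul, ← sub_eq_add_neg]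
    rfl
  have dw : deriv w = fun x => deriv ψ x - (1 + deriv γ x) • deriv φ (B x) := by
    rw [funext hw]
    exact funext fun x => ((Hψ x).sub ((Hφ (B x)).scomp x (HB x))).deriv
  have ddw : deriv (deriv w) = fun x => deriv (deriv ψ) x -
      ((1 + deriv γ x) • (1 + deriv γ x) • deriv (deriv φ) (B x)
        + deriv (deriv γ) x • deriv φ (B x)) := by
    rw [dw]
    exact funext fun x => ((Hdψ x).sub
      (((Hdγ x).const_add 1).smul ((Hdφ (B x)).scomp x (HB x)))).deriv
  have ψ0 : ∀ y, ψ y = w y + φ (B y) := fun y => by rw [hw y]; simp [hBdef]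
  have ψ1 : ∀ y, deriv ψ y = deriv w y + (1 + deriv γ y) • deriv φ (B y) := fun y => by
    rw [dw]; simp
  have ψ2 : ∀ y, deriv (deriv ψ) y = deriv (deriv w) y +
      ((1 + deriv γ y) • (1 + deriv γ y) • deriv (deriv φ) (B y)
        + deriv (deriv γ) y • deriv φ (B y)) := fun y => by
    rw [ddw]; simp
  have hvA : ∀ x, v x = w (A x) + φ (B (A x)) - φ x := fun x => by
    rw [← ψ0 (A x)]; exact hv x
  have cv : Continuous v := by rw [funext hv]; fun_prop
  have cdv : Continuous (deriv v) := by rw [dv]; fun_prop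
  have cddv : Continuous (deriv (deriv v)) := by rw [ddv]; fun_prop
  have cw : Continuous w := by rw [funext hw]; fun_prop
  have cdw : Continuous (deriv w) := by rw [dw]; fun_prop
  have cddw : Continuous (deriv (deriv w)) := by rw [ddw]; fun_prop
  have pw : Function.Periodic w L := fun x => by
    have h : x + L + γ (x + L) + σ / N = x + γ x + σ / N + L := by rw [hγp x]; ring
    rw [hw, hw, h, hφL, hψp x]
  have pdw := periodic_deriv pw
  have pddw := periodic_deriv pdw
  have bφd : ∀ x, ‖φ (B (A x)) - φ x‖ ≤ m * |γ (A x) - γ x| := fun x => by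
    rw [← hBA]
    exact norm_sub_le_of_norm_deriv_le (hφ.differentiable (by norm_num)) bφ₁ _ _
  have ii : ∀ {f : ℝ → ℝ}, Continuous f → IntervalIntegrable f volume 0 L :=
    fun hf => hf.intervalIntegrable _ _
  have J0 : 0 ≤ ∫ x in (0:ℝ)..L, ‖w x‖ ^ 2 := integral_nonneg hL fun _ _ => sq_nonneg _
  have J1 : 0 ≤ ∫ x in (0:ℝ)..L, ‖deriv w x‖ ^ 2 := integral_nonneg hL fun _ _ => sq_nonneg _
  have J2 : 0 ≤ ∫ x in (0:ℝ)..L, ‖deriv (deriv w) x‖ ^ 2 :=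
    integral_nonneg hL fun _ _ => sq_nonneg _
  have V0 : 0 ≤ ∫ x in (0:ℝ)..L, ‖v x‖ ^ 2 := integral_nonneg hL fun _ _ => sq_nonneg _
  have hK2 : 0 ≤ K ^ 2 := sq_nonneg K
  constructor
  · refine sqrt_le_mul_sqrt_add_sqrt (c := c₁) (hC (by linarith)) (by positivity)
      (by positivity)
      (by simp only [Real.norm_eq_abs, sq_abs]; positivity) ?_
    set g : ℝ → ℝ := fun y => ‖w y‖ ^ 2 + ‖deriv w y‖ ^ 2 + ‖deriv (deriv w) y‖ ^ 2
      + (deriv γ y ^ 2 + deriv (deriv γ) y ^ 2) with hg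
    set k : ℝ → ℝ := fun x => deriv γ x ^ 2 + deriv (deriv γ) x ^ 2 with hk
    have cg : Continuous g := by fun_prop
    have ck : Continuous k := by fun_prop
    have pg : Function.Periodic g L := fun x => by
      simp only [hg, pw x, pdw x, pddw x, pdγ x, pddγ x]
    have pt : ∀ x, ‖v x‖ ^ 2 + ‖deriv v x‖ ^ 2 + ‖deriv (deriv v) x‖ ^ 2 ≤
        24 * (9 / 4 + G + 5 * m) ^ 2 * (g (A x) + k x + (γ (A x) - γ x) ^ 2) := by
      intro x
      rw [ddv, dv, hvA x, ← sq_abs (γ (A x) - γ x)]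
      simp only [ψ1 (A x), ψ2 (A x)]
      refine sum_sq_deriv_le hG (abs_nonneg _) (hγ' _) (hγ' _) (bγ₂ _) (bφ₁ _) (bφ₂ _)
        (bφd x) ?_ ?_
      · rw [← hBA]
        exact norm_sub_le_of_norm_deriv_le (dφ.differentiable (by norm_num)) bφ₂ _ _
      · rw [← hBA]
        exact norm_sub_le_of_norm_deriv_le (ddφ.differentiable (by norm_num)) bφ₃ _ _
    have hint : (∫ x in (0:ℝ)..L, ‖v x‖ ^ 2) + (∫ x in (0:ℝ)..L, ‖deriv v x‖ ^ 2)
        + (∫ x in (0:ℝ)..L, ‖deriv (deriv v) x‖ ^ 2) ≤ 24 * (9 / 4 + G + 5 * m) ^ 2 *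
          ((∫ x in (0:ℝ)..L, g (A x)) + (∫ x in (0:ℝ)..L, k x)
            + ∫ x in (0:ℝ)..L, (γ (A x) - γ x) ^ 2) := by
      rw [← intervalIntegral.integral_add (ii (by fun_prop)) (ii (by fun_prop)),
        ← intervalIntegral.integral_add (ii (by fun_prop)) (ii (by fun_prop)),
        ← intervalIntegral.integral_add (ii (by fun_prop)) (ii (by fun_prop)),
        ← intervalIntegral.integral_add (ii (by fun_prop)) (ii (by fun_prop)),
        ← intervalIntegral.integral_const_mul]
      exact integral_mono_on hL (ii (by fun_prop)) (ii (by fun_prop)) fun x _ => pt x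
    have hgA : ∫ x in (0:ℝ)..L, g (A x) ≤ 2 * ∫ x in (0:ℝ)..L, g x :=
      integral_comp_le_two_mul hL HA cA' hAL (fun x => by linarith [(abs_le.1 (hγ' x)).2]) cg pg
        fun x => by positivity
    have hgi : ∫ x in (0:ℝ)..L, g x = (∫ x in (0:ℝ)..L, ‖w x‖ ^ 2)
        + (∫ x in (0:ℝ)..L, ‖deriv w x‖ ^ 2) + (∫ x in (0:ℝ)..L, ‖deriv (deriv w) x‖ ^ 2)
        + ∫ x in (0:ℝ)..L, k x := by
      rw [← intervalIntegral.integral_add (ii (by fun_prop)) (ii (by fun_prop)),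
        ← intervalIntegral.integral_add (ii (by fun_prop)) (ii (by fun_prop)),
        ← intervalIntegral.integral_add (ii (by fun_prop)) (ii (by fun_prop))]
    have hki : ∫ x in (0:ℝ)..L, k x = (∫ x in (0:ℝ)..L, deriv γ x ^ 2)
        + ∫ x in (0:ℝ)..L, deriv (deriv γ) x ^ 2 :=
      intervalIntegral.integral_add (ii (by fun_prop)) (ii (by fun_prop))
    refine hint.trans ?_
    simp only [Real.norm_eq_abs, sq_abs, c₁]
    rw [mul_assoc (24 * _)]
    refine mul_le_mul_of_nonneg_left ?_ (by positivity)
    linarith [mul_nonneg hK2 I2, mul_nonneg hK2 J0, mul_nonneg hK2 J1, mul_nonneg hK2 J2]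
  · refine sqrt_le_mul_sqrt_add_sqrt (c := c₂) (hC (by linarith)) (by positivity) V0
      (by simp only [Real.norm_eq_abs, sq_abs]; positivity) ?_
    have pt : ∀ x, ‖w (A x)‖ ^ 2 ≤ 2 * ‖v x‖ ^ 2 + 2 * m ^ 2 * (γ (A x) - γ x) ^ 2 := by
      intro x
      have h : w (A x) = v x - (φ (B (A x)) - φ x) := by rw [hvA x]; ring
      have h1 : ‖w (A x)‖ ≤ ‖v x‖ + m * |γ (A x) - γ x| := by
        rw [h]
        exact (norm_sub_le _ _).trans (add_le_add_right (bφd x) _)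
      have h2 := pow_le_pow_left₀ (norm_nonneg _) h1 2
      rw [← sq_abs (γ (A x) - γ x)]
      linarith [sq_nonneg (‖v x‖ - m * |γ (A x) - γ x|)]
    have hint : ∫ x in (0:ℝ)..L, ‖w (A x)‖ ^ 2 ≤ 2 * (∫ x in (0:ℝ)..L, ‖v x‖ ^ 2)
        + 2 * m ^ 2 * ∫ x in (0:ℝ)..L, (γ (A x) - γ x) ^ 2 := by
      rw [← intervalIntegral.integral_const_mul, ← intervalIntegral.integral_const_mul,
        ← intervalIntegral.integral_add (ii (by fun_prop)) (ii (by fun_prop))]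
      exact integral_mono_on hL (ii (by fun_prop)) (ii (by fun_prop)) fun x _ => pt x
    have hwA : ∫ x in (0:ℝ)..L, ‖w x‖ ^ 2 ≤ 2 * ∫ x in (0:ℝ)..L, ‖w (A x)‖ ^ 2 :=
      integral_le_two_mul_comp (g := fun y => ‖w y‖ ^ 2) hL HA cA' hAL
        (fun x => by linarith [(abs_le.1 (hγ' x)).1]) (by fun_prop) (fun x => by simp only [pw x])
        fun x => sq_nonneg _
    have hD := mul_le_mul_of_nonneg_left Dint (sq_nonneg m)
    simp only [Real.norm_eq_abs, sq_abs, c₂]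
    have hmK : 0 ≤ m ^ 2 * K ^ 2 := by positivity
    linarith [mul_nonneg hmK I2, mul_nonneg hmK V0]
end
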